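/- Let k be a field, G = GL_{n+1}(k), and P ≤ G the subgroup of upper triangular invertible matrices (Borel subgroup). For I ⊆ {1,…,n} let W_I ≤ S_{n+1} be the subgroup generated by the transpositions s_i = (i, i+1) for i ∈ I, and let P_I = P·W_I·P (products of an upper triangular matrix, a permutation matrix of an element of W_I, and an upper triangular matrix). Then each P_I is a subgroup of G, the map I ↦ P_I is an inclusion-preserving bijection between subsets of {1,…,n} and subgroups of G containing P, and P_{I₁} ⊆ P_{I₂} if and only if I₁ ⊆ I₂. -/

import Mathlib

/-- The Borel subgroup of upper triangular matrices in `GL_{n+1}(k)`, as a set: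
invertible matrices whose entries below the diagonal vanish. -/
def borelSet (k : Type*) [Field k] (n : ℕ) : Set (GL (Fin (n + 1)) k) :=
  {g | ((g : Matrix (Fin (n + 1)) (Fin (n + 1)) k)).BlockTriangular id}

/-- The subgroup `W_I ≤ S_{n+1}` generated by the simple transpositions
`s_i = (i, i+1)` for `i ∈ I ⊆ {1,…,n}`. -/
def weylSub {n : ℕ} (I : Set (Fin n)) : Subgroup (Equiv.Perm (Fin (n + 1))) :=
  Subgroup.closure ((fun i : Fin n => Equiv.swap i.castSucc i.succ) '' I)

/-- The standard parabolic set `P_I = P·W_I·P ⊆ GL_{n+1}(k)`. -/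
def parabolicSet (k : Type*) [Field k] {n : ℕ} (I : Set (Fin n)) :
    Set (GL (Fin (n + 1)) k) :=
  {g | ∃ p ∈ borelSet k n, ∃ σ ∈ weylSub I, ∃ p' ∈ borelSet k n,
    (g : Matrix (Fin (n + 1)) (Fin (n + 1)) k) =
      (p : Matrix (Fin (n + 1)) (Fin (n + 1)) k) * σ.permMatrix k *
        (p' : Matrix (Fin (n + 1)) (Fin (n + 1)) k)}

/-- The permutation matrices as a homomorphism, sending `σ` to the matrix mapping `e_b` to
`e_{σ b}`. -/
noncomputable def permGL (k : Type*) [Field k] (m : Type*) [Fintype m] [DecidableEq m] :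
    Equiv.Perm m →* GL m k :=
  MonoidHom.toHomUnits Matrix.permMatrixHom

section PermGL

variable {k : Type*} [Field k] {m : Type*} [Fintype m] [DecidableEq m]

lemma coe_permGL (σ : Equiv.Perm m) :
    (permGL k m σ : Matrix m m k) = (σ⁻¹).permMatrix k := rfl

lemma permGL_apply (σ : Equiv.Perm m) (a b : m) :
    (permGL k m σ : Matrix m m k) a b = if a = σ b then 1 else 0 := by
  simp [coe_permGL, Equiv.Perm.permMatrix, PEquiv.toMatrix_apply, Equiv.symm_apply_eq]

lemma permGL_apply_self (σ : Equiv.Perm m) (b : m) :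
    (permGL k m σ : Matrix m m k) (σ b) b = 1 := by
  simp [permGL_apply]

lemma mul_permGL_apply (g : Matrix m m k) (σ : Equiv.Perm m) (a b : m) :
    (g * (permGL k m σ : Matrix m m k)) a b = g a (σ b) := by
  simp [Matrix.mul_apply, permGL_apply]

lemma permGL_mul_apply (g : Matrix m m k) (σ : Equiv.Perm m) (a b : m) :
    ((permGL k m σ : Matrix m m k) * g) a b = g (σ⁻¹ a) b := by
  simp [Matrix.mul_apply, permGL_apply, ← Equiv.Perm.inv_eq_iff_eq]

/-- The elementary matrix `1 + c e_{ij}` as an element of `GL`. -/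
noncomputable def transvectionGL {i j : m} (hij : i ≠ j) (c : k) : GL m k :=
  Matrix.GeneralLinearGroup.mkOfDetNeZero (Matrix.transvection i j c)
    (by simp [Matrix.det_transvection_of_ne i j hij])

lemma coe_transvectionGL {i j : m} (hij : i ≠ j) (c : k) :
    (transvectionGL hij c : Matrix m m k) = Matrix.transvection i j c := rfl

lemma transvectionGL_apply {i j : m} (hij : i ≠ j) (c : k) (a b : m) :
    (transvectionGL hij c : Matrix m m k) a b =
      (if a = b then 1 else 0) + if i = a ∧ j = b then c else 0 := by
  simp [coe_transvectionGL, Matrix.transvection, Matrix.one_apply, Matrix.single_apply]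

lemma permGL_conj_transvectionGL (σ : Equiv.Perm m) {i j : m} (hij : i ≠ j) (c : k) :
    permGL k m σ * transvectionGL hij c * permGL k m σ⁻¹ =
      transvectionGL (σ.injective.ne hij) c := by
  ext a b
  rw [Units.val_mul, Units.val_mul, mul_permGL_apply, permGL_mul_apply, transvectionGL_apply,
    transvectionGL_apply]
  simp [Equiv.eq_symm_apply]

lemma transvectionGL_commutator {i j l : m} (hij : i ≠ j) (hjl : j ≠ l) (hil : i ≠ l) (c d : k) :
    transvectionGL hij c * transvectionGL hjl d * transvectionGL hij (-c) *
      transvectionGL hjl (-d) = transvectionGL hil (c * d) := by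
  ext1
  simp only [Units.val_mul, coe_transvectionGL, Matrix.transvection]
  have h1 : ∀ x y : k, Matrix.single i j x * Matrix.single i j y = 0 :=
    fun x y => Matrix.single_mul_single_of_ne _ _ _ _ hij.symm _
  have h2 : ∀ x y : k, Matrix.single j l x * Matrix.single j l y = 0 :=
    fun x y => Matrix.single_mul_single_of_ne _ _ _ _ hjl.symm _
  have h3 : ∀ x y : k, Matrix.single j l x * Matrix.single i j y = 0 :=
    fun x y => Matrix.single_mul_single_of_ne _ _ _ _ hil.symm _
  have h4 : ∀ x y : k, Matrix.single i l x * Matrix.single i j y = 0 :=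
    fun x y => Matrix.single_mul_single_of_ne _ _ _ _ hil.symm _
  have h5 : ∀ x y : k, Matrix.single i l x * Matrix.single j l y = 0 :=
    fun x y => Matrix.single_mul_single_of_ne _ _ _ _ hjl.symm _
  simp only [add_mul, mul_add, one_mul, mul_one, h1, h2, h3, h4, h5,
    Matrix.single_mul_single_same, mul_neg, neg_mul, zero_mul,
    ← Matrix.single_neg]
  abel

lemma transvectionGL_mem_of_forall_mem {Q : Subgroup (GL m k)} {i j l : m} (hij : i ≠ j)
    (hjl : j ≠ l) (hil : i ≠ l) (h : ∀ x, transvectionGL hij x ∈ Q)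
    (h' : ∀ x, transvectionGL hjl x ∈ Q) (x : k) : transvectionGL hil x ∈ Q := by
  rw [← one_mul x, ← transvectionGL_commutator hij hjl hil]
  exact mul_mem (mul_mem (mul_mem (h _) (h' _)) (h _)) (h' _)

end PermGL

section Flag

variable {k : Type*} [Field k] {n : ℕ}

/-- The stabilizer of the partial standard flag consisting of the `span (e_0, …, e_i)`
with `i ∉ I`. -/
def flagStabilizer (k : Type*) [Field k] {n : ℕ} (I : Set (Fin n)) :
    Subgroup (GL (Fin (n + 1)) k) where
  carrier := {g | ∀ i ∉ I, (g : Matrix (Fin (n + 1)) (Fin (n + 1)) k).BlockTriangular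
    fun a => if a ≤ i.castSucc then 0 else 1}
  mul_mem' hg hh i hi := by simpa using (hg i hi).mul (hh i hi)
  one_mem' i _ := by simpa using Matrix.blockTriangular_one
  inv_mem' {g} hg i hi := by
    have := Matrix.blockTriangular_inv_of_blockTriangular (hg i hi)
    simpa [Matrix.coe_units_inv] using this

lemma mem_flagStabilizer {I : Set (Fin n)} {g : GL (Fin (n + 1)) k} :
    g ∈ flagStabilizer k I ↔
      ∀ i ∉ I, ∀ a b, b ≤ i.castSucc → i.castSucc < a → g a b = 0 := by
  refine forall₂_congr fun i _ => forall₂_congr fun a b => ?_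
  rcases le_or_gt a i.castSucc with ha | ha <;> rcases le_or_gt b i.castSucc with hb | hb <;>
    simp [ha, hb, not_le.2, not_lt.2]

lemma mem_borelSet {g : GL (Fin (n + 1)) k} : g ∈ borelSet k n ↔ ∀ a b, b < a → g a b = 0 :=
  Iff.rfl

lemma coe_flagStabilizer_empty :
    (flagStabilizer k (∅ : Set (Fin n)) : Set (GL (Fin (n + 1)) k)) = borelSet k n := by
  ext g
  rw [SetLike.mem_coe, mem_flagStabilizer, mem_borelSet]
  refine ⟨fun h a b hab => ?_, fun h i _ a b hb ha => h a b (hb.trans_lt ha)⟩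
  have hb : b ≠ Fin.last n := (hab.trans_le (Fin.le_last a)).ne
  exact h (b.castPred hb) (by simp) a b (by simp) (by simpa using hab)

lemma mem_flagStabilizer_empty {g : GL (Fin (n + 1)) k} :
    g ∈ flagStabilizer k (∅ : Set (Fin n)) ↔ g ∈ borelSet k n := by
  rw [← coe_flagStabilizer_empty, SetLike.mem_coe]

lemma flagStabilizer_mono {I J : Set (Fin n)} (h : I ⊆ J) :
    flagStabilizer k I ≤ flagStabilizer k J :=
  fun _ hg i hi => hg i fun h' => hi (h h')

lemma borelSet_subset_flagStabilizer (I : Set (Fin n)) :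
    borelSet k n ⊆ flagStabilizer k I := by
  rw [← coe_flagStabilizer_empty]
  exact flagStabilizer_mono (Set.empty_subset I)

lemma permGL_mem_flagStabilizer {I : Set (Fin n)} {σ : Equiv.Perm (Fin (n + 1))} :
    permGL k _ σ ∈ flagStabilizer k I ↔ ∀ i ∉ I, ∀ b, b ≤ i.castSucc → σ b ≤ i.castSucc := by
  rw [mem_flagStabilizer]
  refine forall₂_congr fun i _ => ⟨fun h b hb => ?_, fun h a b hb ha => ?_⟩
  · by_contra! hlt
    simpa [permGL_apply_self] using h (σ b) b hb hlt
  · rw [permGL_apply, if_neg]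
    rintro rfl
    exact (h b hb).not_gt ha

lemma permGL_swap_mem_flagStabilizer {I : Set (Fin n)} {i : Fin n} :
    permGL k _ (Equiv.swap i.castSucc i.succ) ∈ flagStabilizer k I ↔ i ∈ I := by
  rw [permGL_mem_flagStabilizer]
  refine ⟨fun h => ?_, fun hi j hj b hb => ?_⟩
  · by_contra hi
    simpa using h i hi i.castSucc le_rfl
  · have hij : i ≠ j := fun h => hj (h ▸ hi)
    rw [Equiv.swap_apply_def]
    split_ifs <;> simp only [Fin.ext_iff, Fin.le_def, Fin.val_castSucc, Fin.val_succ, ne_eq] at * <;>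
      omega

/-- A permutation preserving the initial segments cut out by the complement of `I` is a product
of the simple transpositions indexed by `I`. -/
lemma mem_weylSub_of_forall_le {I : Set (Fin n)} (σ : Equiv.Perm (Fin (n + 1)))
    (h : ∀ i ∉ I, ∀ b, b ≤ i.castSucc → σ b ≤ i.castSucc) : σ ∈ weylSub I := by
  induction hx : toLex (σ : Fin (n + 1) → Fin (n + 1)) using WellFoundedLT.induction
    generalizing σ with
  | ind x ih =>
  subst hx
  by_cases hmono : StrictMono σ
  · have : σ = 1 := by
      refine DFunLike.coe_injective ((hmono.range_inj strictMono_id).1 ?_)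
      simp [σ.surjective.range_eq]
    rw [this]
    exact one_mem _
  · rw [Fin.strictMono_iff_lt_succ] at hmono
    push Not at hmono
    obtain ⟨i, hi⟩ := hmono
    have hlt : σ i.succ < σ i.castSucc :=
      hi.lt_of_ne (σ.injective.ne Fin.castSucc_lt_succ.ne')
    have hiI : i ∈ I := by
      by_contra hiI
      have hmaps : Set.MapsTo σ (Set.Iic i.castSucc) (Set.Iic i.castSucc) := h i hiI
      have hsurj := ((Set.toFinite _).injOn_iff_bijOn_of_mapsTo hmaps).1 σ.injective.injOn
      have hle := hlt.le.trans (h i hiI _ le_rfl)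
      obtain ⟨b, hb, hb'⟩ := hsurj.surjOn hle
      rw [σ.injective hb'] at hb
      exact Fin.castSucc_lt_succ.not_ge hb
    have hs : Equiv.swap i.castSucc i.succ ∈ weylSub I :=
      Subgroup.subset_closure ⟨i, hiI, rfl⟩
    have hs' := permGL_mem_flagStabilizer.1
      (permGL_swap_mem_flagStabilizer (k := ℚ).2 hiI)
    have := ih _ (Pi.lex_desc Fin.castSucc_lt_succ.le hlt)
      (σ * Equiv.swap i.castSucc i.succ)
      (fun j hj b hb => h j hj _ (hs' j hj b hb)) rfl
    exact (Subgroup.mul_mem_cancel_right _ hs).1 this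

lemma permGL_mem_of_mem_weylSub {I : Set (Fin n)} {Q : Subgroup (GL (Fin (n + 1)) k)}
    (hQ : ∀ i ∈ I, permGL k _ (Equiv.swap i.castSucc i.succ) ∈ Q)
    {σ : Equiv.Perm (Fin (n + 1))} (hσ : σ ∈ weylSub I) : permGL k _ σ ∈ Q := by
  have : weylSub I ≤ Q.comap (permGL k _) := by
    rw [weylSub, Subgroup.closure_le]
    rintro _ ⟨i, hi, rfl⟩
    exact hQ i hi
  exact this hσ

lemma mem_parabolicSet {I : Set (Fin n)} {g : GL (Fin (n + 1)) k} :
    g ∈ parabolicSet k I ↔ ∃ p ∈ borelSet k n, ∃ σ ∈ weylSub I, ∃ p' ∈ borelSet k n,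
      g = p * permGL k _ σ * p' := by
  constructor
  · rintro ⟨p, hp, σ, hσ, p', hp', h⟩
    exact ⟨p, hp, σ⁻¹, inv_mem hσ, p', hp', Units.ext (by
      rw [Units.val_mul, Units.val_mul, coe_permGL, inv_inv, h])⟩
  · rintro ⟨p, hp, σ, hσ, p', hp', rfl⟩
    exact ⟨p, hp, σ⁻¹, inv_mem hσ, p', hp', by
      rw [Units.val_mul, Units.val_mul, coe_permGL]⟩

lemma exists_mem_borelSet_coe_eq {M : Matrix (Fin (n + 1)) (Fin (n + 1)) k}
    (hM : M.BlockTriangular id) (hdiag : ∀ a, M a a = 1) :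
    ∃ p ∈ borelSet k n, (p : Matrix (Fin (n + 1)) (Fin (n + 1)) k) = M :=
  ⟨Matrix.GeneralLinearGroup.mkOfDetNeZero M (by simp [Matrix.det_of_isUpperTriangular hM, hdiag]),
    hM, rfl⟩

/-- Adding multiples of row `r` to higher rows is left multiplication by an upper triangular
matrix. -/
lemma exists_borel_mul_apply (r : Fin (n + 1)) (c : Fin (n + 1) → k)
    (hc : ∀ a, r ≤ a → c a = 0) (h : GL (Fin (n + 1)) k) :
    ∃ p ∈ borelSet k n, ∀ a b, (p * h) a b = h a b - c a * h r b := by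
  obtain ⟨p, hp, hp'⟩ := exists_mem_borelSet_coe_eq (k := k) (n := n)
    (M := 1 - Matrix.vecMulVec c (Pi.single r 1))
    (fun a b (hab : b < a) => by
      by_cases hb : b = r
      · subst hb; simp [Matrix.vecMulVec_apply, hc a hab.le, hab.ne']
      · simp [Matrix.vecMulVec_apply, hb, hab.ne'])
    (fun a => by
      by_cases ha : a = r
      · subst ha; simp [Matrix.vecMulVec_apply, hc a le_rfl]
      · simp [Matrix.vecMulVec_apply, ha])
  refine ⟨p, hp, fun a b => ?_⟩
  rw [Units.val_mul, hp']
  rw [sub_mul, one_mul, Matrix.sub_apply]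
  simp [Matrix.mul_apply, Matrix.vecMulVec_apply, Pi.single_apply]

/-- Adding multiples of column `r` to later columns is right multiplication by an upper triangular
matrix. -/
lemma exists_mul_borel_apply (r : Fin (n + 1)) (c : Fin (n + 1) → k)
    (hc : ∀ a, a ≤ r → c a = 0) (h : GL (Fin (n + 1)) k) :
    ∃ p ∈ borelSet k n, ∀ a b, (h * p) a b = h a b - h a r * c b := by
  obtain ⟨p, hp, hp'⟩ := exists_mem_borelSet_coe_eq (k := k) (n := n)
    (M := 1 - Matrix.vecMulVec (Pi.single r 1) c)
    (fun a b (hab : b < a) => by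
      by_cases ha : a = r
      · subst ha; simp [Matrix.vecMulVec_apply, hc b hab.le, hab.ne']
      · simp [Matrix.vecMulVec_apply, ha, hab.ne'])
    (fun a => by
      by_cases ha : a = r
      · subst ha; simp [Matrix.vecMulVec_apply, hc a le_rfl]
      · simp [Matrix.vecMulVec_apply, ha])
  refine ⟨p, hp, fun a b => ?_⟩
  rw [Units.val_mul, hp']
  rw [mul_sub, mul_one, Matrix.sub_apply]
  simp [Matrix.mul_apply, Matrix.vecMulVec_apply, Pi.single_apply]

lemma exists_apply_ne_zero {m : Type*} [Fintype m] [DecidableEq m] (h : GL m k) (j : m) :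
    ∃ r, h r j ≠ 0 := by
  by_contra! h0
  have : ((h⁻¹ * h : GL m k) : Matrix m m k) j j = 0 := by
    rw [Units.val_mul, Matrix.mul_apply]
    exact Finset.sum_eq_zero fun x _ => by rw [h0, mul_zero]
  simp at this

/-- Gaussian elimination of the first `m` columns. -/
lemma exists_borel_mul_mul_borel_clear (g : GL (Fin (n + 1)) k) (m : ℕ) (hm : m ≤ n + 1) :
    ∃ p ∈ flagStabilizer k (∅ : Set (Fin n)), ∃ p' ∈ flagStabilizer k (∅ : Set (Fin n)),
      ∀ j : Fin (n + 1), j.val < m → ∃ r, (∀ b ≠ j, (p * g * p') r b = 0) ∧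
        ∀ a ≠ r, (p * g * p') a j = 0 := by
  induction m with
  | zero => exact ⟨1, one_mem _, 1, one_mem _, fun j hj => absurd hj (by simp)⟩
  | succ m ih =>
  obtain ⟨p, hp, p', hp', hclear⟩ := ih (by omega)
  generalize hh : p * g * p' = h at hclear
  let j₀ : Fin (n + 1) := ⟨m, hm⟩
  obtain ⟨r, hr, hmax⟩ : ∃ r, h r j₀ ≠ 0 ∧ ∀ a, r < a → h a j₀ = 0 := by
    obtain ⟨r, hr⟩ := (Set.toFinite {r | h r j₀ ≠ 0}).exists_maximal (exists_apply_ne_zero h j₀)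
    refine ⟨r, hr.prop, fun a ha => ?_⟩
    by_contra h0
    exact hr.not_gt h0 ha
  have hrow : ∀ b, b < j₀ → h r b = 0 := fun b hb => by
    obtain ⟨r', h1, h2⟩ := hclear b hb
    exact h2 r (by rintro rfl; exact hr (h1 _ hb.ne'))
  obtain ⟨q, hq, hqh⟩ := exists_borel_mul_apply r
    (fun a => if a < r then h a j₀ / h r j₀ else 0) (fun a ha => if_neg ha.not_gt) h
  obtain ⟨q', hq', hqh'⟩ := exists_mul_borel_apply j₀
    (fun b => if j₀ < b then h r b / h r j₀ else 0) (fun a ha => if_neg ha.not_gt) (q * h)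
  refine ⟨q * p, mul_mem (mem_flagStabilizer_empty.2 hq) hp, p' * q',
    mul_mem hp' (mem_flagStabilizer_empty.2 hq'), fun j hj => ?_⟩
  have hassoc : q * p * g * (p' * q') = q * h * q' := by simp only [← hh, mul_assoc]
  rw [hassoc]
  have hcol : ∀ a ≠ r, (q * h) a j₀ = 0 := fun a ha => by
    rw [hqh]
    rcases ha.lt_or_gt with ha | ha
    · simp [ha, hr]
    · simp [ha.not_gt, hmax a ha]
  have hrow' : ∀ b, (q * h) r b = h r b := fun b => by simp [hqh]
  rcases (Nat.lt_succ_iff.1 hj).lt_or_eq with hj | hj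
  · have hj' : j < j₀ := hj
    obtain ⟨r', h1, h2⟩ := hclear j hj
    have hr' : r' ≠ r := by rintro rfl; exact hr (h1 _ hj'.ne')
    refine ⟨r', fun b hb => ?_, fun a ha => ?_⟩
    · rw [hqh', hcol r' hr', hqh, h1 b hb, h1 j₀ hj'.ne']
      simp
    · rw [hqh', hqh, h2 a ha, hrow j hj']
      simp [hj'.not_gt]
  · obtain rfl : j = j₀ := Fin.ext hj
    refine ⟨r, fun b hb => ?_, fun a ha => ?_⟩
    · rw [hqh', hrow', hrow']
      rcases hb.lt_or_gt with hb | hb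
      · simp [hrow b hb, hb.not_gt]
      · simp [hb, mul_div_cancel₀ _ hr]
    · rw [hqh', hcol a ha]
      simp

/-- The Bruhat decomposition of `GL`. -/
lemma exists_bruhat (g : GL (Fin (n + 1)) k) :
    ∃ p ∈ borelSet k n, ∃ σ, ∃ p' ∈ borelSet k n, g = p * permGL k _ σ * p' := by
  simp only [← mem_flagStabilizer_empty]
  obtain ⟨p, hp, p', hp', h⟩ := exists_borel_mul_mul_borel_clear g (n + 1) le_rfl
  choose f hf hf' using fun j : Fin (n + 1) => h j j.2
  have hne : ∀ j, (p * g * p') (f j) j ≠ 0 := fun j h0 => by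
    obtain ⟨r, hr⟩ := exists_apply_ne_zero (p * g * p') j
    by_cases hrj : r = f j
    · exact hr (hrj ▸ h0)
    · exact hr (hf' j r hrj)
  have hinj : Function.Injective f := fun i j hij => by
    by_contra hne'
    exact hne i (hij ▸ hf j i hne')
  let σ := Equiv.ofBijective f (Finite.injective_iff_bijective.1 hinj)
  have hD : p * g * p' * permGL k _ σ⁻¹ ∈ flagStabilizer k (∅ : Set (Fin n)) := by
    rw [mem_flagStabilizer_empty]
    intro a b (hab : b < a)
    rw [Units.val_mul, mul_permGL_apply]
    refine hf' _ _ ?_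
    have : f (σ⁻¹ b) = b := σ.apply_symm_apply b
    rw [this]
    exact hab.ne'
  refine ⟨p⁻¹ * (p * g * p' * permGL k _ σ⁻¹), mul_mem (inv_mem hp) hD, σ, p'⁻¹, inv_mem hp', ?_⟩
  simp [map_inv, mul_assoc]

lemma coe_flagStabilizer (I : Set (Fin n)) :
    (flagStabilizer k I : Set (GL (Fin (n + 1)) k)) = parabolicSet k I := by
  ext g
  rw [SetLike.mem_coe, mem_parabolicSet]
  constructor
  · intro hg
    obtain ⟨p, hp, σ, p', hp', rfl⟩ := exists_bruhat g
    refine ⟨p, hp, σ, mem_weylSub_of_forall_le σ (permGL_mem_flagStabilizer (k := k).1 ?_),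
      p', hp', rfl⟩
    rwa [Subgroup.mul_mem_cancel_right _ (borelSet_subset_flagStabilizer I hp'),
      Subgroup.mul_mem_cancel_left _ (borelSet_subset_flagStabilizer I hp)] at hg
  · rintro ⟨p, hp, σ, hσ, p', hp', rfl⟩
    exact mul_mem (mul_mem (borelSet_subset_flagStabilizer I hp)
      (permGL_mem_of_mem_weylSub (fun i hi => permGL_swap_mem_flagStabilizer.2 hi) hσ))
      (borelSet_subset_flagStabilizer I hp')

lemma transvectionGL_mem_borelSet {i j : Fin (n + 1)} (hij : i < j) (c : k) :
    transvectionGL hij.ne c ∈ borelSet k n := by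
  intro a b (hab : b < a)
  rw [transvectionGL_apply, if_neg hab.ne', if_neg, add_zero]
  rintro ⟨rfl, rfl⟩
  exact hab.not_gt hij

/-- A subgroup containing the Borel subgroup and the simple negative root subgroup element at `i`
contains the simple reflection `s_i`. -/
lemma permGL_swap_mem_of_transvectionGL_mem {Q : Subgroup (GL (Fin (n + 1)) k)}
    (hQ : borelSet k n ⊆ Q) (i : Fin n)
    (h : transvectionGL (Fin.castSucc_lt_succ (i := i)).ne' (1 : k) ∈ Q) :
    permGL k _ (Equiv.swap i.castSucc i.succ) ∈ Q := by
  have hmem : transvectionGL (Fin.castSucc_lt_succ (i := i)).ne' (1 : k) ∈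
      flagStabilizer k {i} := by
    rw [mem_flagStabilizer]
    intro j hj a b hb ha
    rw [transvectionGL_apply, if_neg (hb.trans_lt ha).ne', if_neg, add_zero]
    rintro ⟨rfl, rfl⟩
    refine hj (Fin.ext ?_)
    simp only [Fin.le_def, Fin.lt_def, Fin.val_castSucc, Fin.val_succ] at hb ha
    omega
  rw [← SetLike.mem_coe, coe_flagStabilizer, mem_parabolicSet] at hmem
  obtain ⟨p, hp, σ, hσ, p', hp', heq⟩ := hmem
  have hσQ : permGL k _ σ ∈ Q := by
    rwa [heq, Subgroup.mul_mem_cancel_right _ (hQ hp'),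
      Subgroup.mul_mem_cancel_left _ (hQ hp)] at h
  rw [weylSub, Set.image_singleton, Subgroup.mem_closure_singleton] at hσ
  obtain ⟨m, rfl⟩ := hσ
  have hsq : Equiv.swap i.castSucc i.succ ^ (2 : ℤ) = 1 := by
    rw [zpow_two, Equiv.swap_mul_self]
  obtain ⟨l, rfl | rfl⟩ := Int.even_or_odd' m
  · rw [zpow_mul, hsq, one_zpow, map_one, mul_one] at heq
    have hB : transvectionGL (Fin.castSucc_lt_succ (i := i)).ne' (1 : k) ∈ borelSet k n := by
      rw [← mem_flagStabilizer_empty] at hp hp' ⊢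
      exact heq ▸ mul_mem hp hp'
    have := mem_borelSet.1 hB i.succ i.castSucc Fin.castSucc_lt_succ
    rw [transvectionGL_apply, if_neg (Fin.castSucc_lt_succ (i := i)).ne', if_pos ⟨rfl, rfl⟩,
      zero_add] at this
    exact absurd this one_ne_zero
  · rwa [zpow_add, zpow_mul, hsq, one_zpow, one_mul, zpow_one] at hσQ

lemma permGL_swap_mem_of_lt {Q : Subgroup (GL (Fin (n + 1)) k)} (hQ : borelSet k n ⊆ Q)
    {σ : Equiv.Perm (Fin (n + 1))} (hσ : permGL k _ σ ∈ Q) {i : Fin n} {a : Fin (n + 1)}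
    (ha : a ≤ i.castSucc) (hσa : i.castSucc < σ a) :
    permGL k _ (Equiv.swap i.castSucc i.succ) ∈ Q := by
  obtain ⟨b, hb, hσb⟩ : ∃ b, i.castSucc < b ∧ σ b ≤ i.castSucc := by
    by_contra! hcon
    have hmaps : Set.MapsTo σ (Set.Ioi i.castSucc) (Set.Ioi i.castSucc) := hcon
    have hbij := ((Set.toFinite _).injOn_iff_bijOn_of_mapsTo hmaps).1 σ.injective.injOn
    obtain ⟨b, hb, hb'⟩ := hbij.surjOn hσa
    rw [σ.injective hb'] at hb
    exact hb.not_ge ha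
  have hroot : ∀ x : k, transvectionGL (σ.injective.ne (ha.trans_lt hb).ne) x ∈ Q := fun x => by
    rw [← permGL_conj_transvectionGL σ (ha.trans_lt hb).ne, map_inv]
    exact mul_mem (mul_mem hσ (hQ (transvectionGL_mem_borelSet (ha.trans_lt hb) x))) (inv_mem hσ)
  generalize_proofs hne at hroot
  generalize σ a = c at *
  generalize σ b = d at *
  have hi : i.castSucc < i.succ := Fin.castSucc_lt_succ
  have hd : d < i.succ := hσb.trans_lt hi
  have hrow : ∀ x : k, transvectionGL hd.ne' x ∈ Q := by
    rcases (Fin.castSucc_lt_iff_succ_le.1 hσa).eq_or_lt with hc | hc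
    · subst hc; exact hroot
    · exact transvectionGL_mem_of_forall_mem hc.ne hne hd.ne'
        (fun x => hQ (transvectionGL_mem_borelSet hc x)) hroot
  refine permGL_swap_mem_of_transvectionGL_mem hQ i ?_
  rcases hσb.eq_or_lt with hd' | hd'
  · subst hd'; exact hrow 1
  · exact transvectionGL_mem_of_forall_mem hd.ne' hd'.ne hi.ne' hrow
      (fun x => hQ (transvectionGL_mem_borelSet hd' x)) 1

end Flag

/-- Each `P_I = P·W_I·P` is a subgroup of `GL_{n+1}(k)` containing the
Borel subgroup `P`; the map `I ↦ P_I` is an inclusion-preserving bijection between the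
subsets of `{1,…,n}` and the subgroups of `GL_{n+1}(k)` containing `P`, and
`P_{I₁} ⊆ P_{I₂}` iff `I₁ ⊆ I₂`. -/
theorem stmt15 (k : Type*) [Field k] (n : ℕ) :
    (∀ I : Set (Fin n), ∃ Q : Subgroup (GL (Fin (n + 1)) k),
        (Q : Set (GL (Fin (n + 1)) k)) = parabolicSet k I) ∧
      (∀ I : Set (Fin n), borelSet k n ⊆ parabolicSet k I) ∧
      (∀ Q : Subgroup (GL (Fin (n + 1)) k),
        borelSet k n ⊆ (Q : Set (GL (Fin (n + 1)) k)) →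
          ∃! I : Set (Fin n), (Q : Set (GL (Fin (n + 1)) k)) = parabolicSet k I) ∧
      ∀ I₁ I₂ : Set (Fin n), parabolicSet k I₁ ⊆ parabolicSet k I₂ ↔ I₁ ⊆ I₂ := by
  have hle (I₁ I₂ : Set (Fin n)) : parabolicSet k I₁ ⊆ parabolicSet k I₂ ↔ I₁ ⊆ I₂ := by
    rw [← coe_flagStabilizer, ← coe_flagStabilizer, SetLike.coe_subset_coe]
    exact ⟨fun h _ hi => permGL_swap_mem_flagStabilizer.1
      (h (permGL_swap_mem_flagStabilizer.2 hi)), flagStabilizer_mono⟩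
  refine ⟨fun I => ⟨flagStabilizer k I, coe_flagStabilizer I⟩,
    fun I => coe_flagStabilizer (k := k) I ▸ borelSet_subset_flagStabilizer I,
    fun Q hQ => ?_, hle⟩
  refine existsUnique_of_exists_of_unique ?_ fun I J hI hJ =>
    Set.Subset.antisymm ((hle I J).1 (hI ▸ hJ).subset) ((hle J I).1 (hI ▸ hJ).symm.subset)
  refine ⟨{i | permGL k _ (Equiv.swap i.castSucc i.succ) ∈ Q}, Set.Subset.antisymm ?_ ?_⟩
  · intro g hg
    obtain ⟨p, hp, σ, p', hp', rfl⟩ := exists_bruhat g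
    rw [SetLike.mem_coe, Subgroup.mul_mem_cancel_right _ (hQ hp'),
      Subgroup.mul_mem_cancel_left _ (hQ hp)] at hg
    refine mem_parabolicSet.2 ⟨p, hp, σ, mem_weylSub_of_forall_le σ fun i hi a ha => ?_,
      p', hp', rfl⟩
    by_contra! hlt
    exact hi (permGL_swap_mem_of_lt hQ hg ha hlt)
  · intro g hg
    obtain ⟨p, hp, σ, hσ, p', hp', rfl⟩ := mem_parabolicSet.1 hg
    exact mul_mem (mul_mem (hQ hp) (permGL_mem_of_mem_weylSub (fun _ hi => hi) hσ)) (hQ hp')
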